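/- With ξ ∈ L^∞(0,T;ℓ²) fixed and T̂(v)(t) = ∫₀ᵗ σ(s,ξ(s))v(s) ds, the operator T̂ : L²(0,T;H) → C([0,T],ℓ²) is compact: the image of any bounded subset of L²(0,T;H) is precompact in C([0,T],ℓ²). -/

import Mathlib

open MeasureTheory Set

noncomputable section

/-- `ℓ²(ℤ^N)`: square-summable real sequences indexed by `ℤ^N`. -/
abbrev ESp (N : ℕ) := lp (fun _ : Fin N → ℤ => ℝ) 2

/-- `H = ℓ²(ℕ)`, a separable Hilbert space. -/
abbrev HSp := lp (fun _ : ℕ => ℝ) 2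

/-- The standard orthonormal basis vector `e_k` of `H = ℓ²(ℕ)`. -/
def eVec (k : ℕ) : HSp := lp.single 2 k (1 : ℝ)

/-- `v` belongs to `L²(0,T;H)`. -/
def IsControl (T : ℝ) (v : ℝ → HSp) : Prop :=
  AEStronglyMeasurable v (volume.restrict (Icc 0 T)) ∧
    IntegrableOn (fun t => ‖v t‖ ^ 2) (Icc 0 T)

/-- The operator `T̂(v)(t) = ∫₀ᵗ Φ(s) v(s) ds`, where `Φ(s) = σ(s, ξ(s))` is the
Hilbert–Schmidt operator-valued map coming from a fixed `ξ ∈ L^∞(0,T;ℓ²)`. -/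
def hatT {N : ℕ} (Φ : ℝ → (HSp →L[ℝ] ESp N)) (v : ℝ → HSp) (t : ℝ) : ESp N :=
  ∫ s in (0:ℝ)..t, Φ s (v s)

open Filter Topology

section HilbertSchmidt

variable {H F ι κ : Type*} [NormedAddCommGroup H] [InnerProductSpace ℝ H]
  [NormedAddCommGroup F] [InnerProductSpace ℝ F]

/-- The operator norm is dominated by the Hilbert–Schmidt norm. -/
theorem opNorm_sq_le_tsum (e : HilbertBasis κ ℝ H) (A : H →L[ℝ] F)
    (hA : Summable fun k => ‖A (e k)‖ ^ 2) : ‖A‖ ^ 2 ≤ ∑' k, ‖A (e k)‖ ^ 2 := by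
  have hS : 0 ≤ ∑' k, ‖A (e k)‖ ^ 2 := tsum_nonneg fun k => by positivity
  rw [← Real.le_sqrt (norm_nonneg _) hS]
  refine A.opNorm_le_bound (Real.sqrt_nonneg _) fun x => ?_
  have hx : HasSum (fun k => e.repr x k • A (e k)) (A x) := by
    simpa using (e.hasSum_repr x).mapL A
  have hr : HasSum (fun k => ‖e.repr x k‖ ^ (2 : ℝ)) (‖x‖ ^ (2 : ℝ)) := by
    simpa using lp.hasSum_norm (p := 2) (by norm_num) (e.repr x)
  have ha : HasSum (fun k => ‖A (e k)‖ ^ (2 : ℝ)) (√(∑' k, ‖A (e k)‖ ^ 2) ^ (2 : ℝ)) := by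
    simpa [Real.sq_sqrt hS] using hA.hasSum
  obtain ⟨C, -, hC, hsum⟩ := Real.inner_le_Lp_mul_Lq_hasSum_of_nonneg
    Real.HolderConjugate.two_two (Real.sqrt_nonneg _) (norm_nonneg x)
    (fun k => norm_nonneg (A (e k))) (fun k => norm_nonneg (e.repr x k)) ha hr
  refine le_trans (hx.norm_le_of_bounded hsum fun k => ?_) hC
  rw [norm_smul, mul_comm]

/-- The span of finitely many vectors of a Hilbert basis. -/
def finSpan (b : HilbertBasis ι ℝ F) (s : Finset ι) : Submodule ℝ F :=
  Submodule.span ℝ (b '' s)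

instance (b : HilbertBasis ι ℝ F) (s : Finset ι) : FiniteDimensional ℝ (finSpan b s) :=
  FiniteDimensional.span_of_finite ℝ (s.finite_toSet.image b)

theorem tendsto_starProjection_finSpan (b : HilbertBasis ι ℝ F) (x : F) :
    Tendsto (fun s => (finSpan b s).starProjection x) atTop (𝓝 x) := by
  refine Submodule.starProjection_tendsto_self (finSpan b)
    (fun s t hst => Submodule.span_mono (image_mono (Finset.coe_subset.2 hst))) x ?_
  rw [← b.dense_span]
  refine Submodule.topologicalClosure_mono (Submodule.span_le.2 ?_)
  rintro _ ⟨i, rfl⟩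
  exact Submodule.mem_iSup_of_mem {i} (Submodule.subset_span ⟨i, by simp, rfl⟩)

theorem norm_sub_starProjection_le (U : Submodule ℝ F) [U.HasOrthogonalProjection] (x : F) :
    ‖x - U.starProjection x‖ ≤ ‖x‖ := by
  rw [← U.starProjection_orthogonal_val]
  exact Uᗮ.norm_starProjection_apply_le x

/-- The complementary projections to an exhaustion kill a Hilbert–Schmidt operator in norm. -/
theorem tendsto_norm_sq_sub_starProjection_comp (b : HilbertBasis ι ℝ F)
    (e : HilbertBasis κ ℝ H) (A : H →L[ℝ] F) (hA : Summable fun k => ‖A (e k)‖ ^ 2) :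
    Tendsto (fun s => ‖A - (finSpan b s).starProjection ∘L A‖ ^ 2) atTop (𝓝 0) := by
  have hle : ∀ s k, ‖(A - (finSpan b s).starProjection ∘L A) (e k)‖ ^ 2 ≤ ‖A (e k)‖ ^ 2 :=
    fun s k => pow_le_pow_left₀ (norm_nonneg _)
      (norm_sub_starProjection_le (finSpan b s) (A (e k))) 2
  have htsum : Tendsto (fun s => ∑' k, ‖(A - (finSpan b s).starProjection ∘L A) (e k)‖ ^ 2)
      atTop (𝓝 (∑' _ : κ, (0 : ℝ))) := by
    refine tendsto_tsum_of_dominated_convergence hA (fun k => ?_)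
      (Eventually.of_forall fun s k => ?_)
    · simpa using ((tendsto_const_nhds (x := A (e k))).sub
        (tendsto_starProjection_finSpan b (A (e k)))).norm.pow 2
    · simpa using hle s k
  rw [tsum_zero] at htsum
  exact squeeze_zero (fun s => by positivity)
    (fun s => opNorm_sq_le_tsum e _ (hA.of_nonneg_of_le (fun k => by positivity) (hle s))) htsum

/-- A bounded set approximated uniformly by its projections to finite-dimensional subspaces is
totally bounded. -/
theorem totallyBounded_of_starProjection (b : HilbertBasis ι ℝ F) {S : Set F} {C : ℝ}
    (hC : ∀ x ∈ S, ‖x‖ ≤ C)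
    (hS : ∀ ε > 0, ∃ s, ∀ x ∈ S, ‖x - (finSpan b s).starProjection x‖ < ε) :
    TotallyBounded S := by
  rw [Metric.totallyBounded_iff]
  intro ε hε
  obtain ⟨s, hs⟩ := hS (ε / 2) (half_pos hε)
  have hK : TotallyBounded (Subtype.val '' Metric.closedBall (0 : finSpan b s) C) :=
    ((isCompact_closedBall _ _).image continuous_subtype_val).totallyBounded
  obtain ⟨t, ht, hcover⟩ := Metric.totallyBounded_iff.1 hK (ε / 2) (half_pos hε)
  refine ⟨t, ht, fun x hx => ?_⟩
  have hPx : (finSpan b s).starProjection x ∈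
      Subtype.val '' Metric.closedBall (0 : finSpan b s) C := by
    refine ⟨⟨_, (finSpan b s).starProjection_apply_mem x⟩, ?_, rfl⟩
    rw [mem_closedBall_zero_iff]
    exact ((finSpan b s).norm_starProjection_apply_le x).trans (hC x hx)
  obtain ⟨y, hy, hxy⟩ := mem_iUnion₂.1 (hcover hPx)
  refine mem_iUnion₂.2 ⟨y, hy, ?_⟩
  rw [Metric.mem_ball] at hxy ⊢
  have hd : dist x ((finSpan b s).starProjection x) < ε / 2 := by
    rw [dist_eq_norm]; exact hs x hx
  linarith [dist_triangle x ((finSpan b s).starProjection x) y]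

variable {α : Type*} [MeasurableSpace α] {μ : Measure α}

theorem integrable_clm_apply {Ψ : α → H →L[ℝ] F} {v : α → H}
    (hΨ : AEStronglyMeasurable Ψ μ) (hΨ2 : Integrable (fun a => ‖Ψ a‖ ^ 2) μ)
    (hv : AEStronglyMeasurable v μ) (hv2 : Integrable (fun a => ‖v a‖ ^ 2) μ) :
    Integrable (fun a => Ψ a (v a)) μ := by
  refine (hΨ2.add hv2).mono'
    ((ContinuousLinearMap.id ℝ (H →L[ℝ] F)).aestronglyMeasurable_comp₂ hΨ hv)
    (Eventually.of_forall fun a => ?_)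
  refine ((Ψ a).le_opNorm (v a)).trans ?_
  simp only [Pi.add_apply]
  nlinarith [sq_nonneg (‖Ψ a‖ - ‖v a‖), sq_nonneg ‖Ψ a‖, sq_nonneg ‖v a‖]

/-- Cauchy–Schwarz for the integral of an operator-valued map applied to a vector-valued map. -/
theorem norm_integral_clm_apply_le {Ψ : α → H →L[ℝ] F} {v : α → H}
    (hΨ : AEStronglyMeasurable Ψ μ) (hΨ2 : Integrable (fun a => ‖Ψ a‖ ^ 2) μ)
    (hv : AEStronglyMeasurable v μ) (hv2 : Integrable (fun a => ‖v a‖ ^ 2) μ) :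
    ‖∫ a, Ψ a (v a) ∂μ‖ ≤ √(∫ a, ‖Ψ a‖ ^ 2 ∂μ) * √(∫ a, ‖v a‖ ^ 2 ∂μ) := by
  have hΨL : MemLp (fun a => ‖Ψ a‖) 2 μ :=
    (memLp_two_iff_integrable_sq hΨ.norm).2 hΨ2
  have hvL : MemLp (fun a => ‖v a‖) 2 μ :=
    (memLp_two_iff_integrable_sq hv.norm).2 hv2
  have hCS := integral_mul_le_Lp_mul_Lq_of_nonneg (μ := μ) Real.HolderConjugate.two_two
    (Eventually.of_forall fun a => norm_nonneg (Ψ a))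
    (Eventually.of_forall fun a => norm_nonneg (v a)) (by simpa using hΨL) (by simpa using hvL)
  simp only [Real.rpow_two, ← Real.sqrt_eq_rpow] at hCS
  exact (norm_integral_le_of_norm_le (hΨL.integrable_mul hvL)
    (Eventually.of_forall fun a => (Ψ a).le_opNorm (v a))).trans hCS

theorem norm_setIntegral_clm_apply_le {A B : Set α} (hAB : A ⊆ B) {Ψ : α → H →L[ℝ] F} {v : α → H}
    (hΨ : AEStronglyMeasurable Ψ (μ.restrict B)) (hΨ2 : IntegrableOn (fun a => ‖Ψ a‖ ^ 2) B μ)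
    (hv : AEStronglyMeasurable v (μ.restrict B)) (hv2 : IntegrableOn (fun a => ‖v a‖ ^ 2) B μ) :
    ‖∫ a in A, Ψ a (v a) ∂μ‖ ≤ √(∫ a in A, ‖Ψ a‖ ^ 2 ∂μ) * √(∫ a in B, ‖v a‖ ^ 2 ∂μ) := by
  refine (norm_integral_clm_apply_le (hΨ.mono_set hAB) (hΨ2.mono_set hAB) (hv.mono_set hAB)
    (hv2.mono_set hAB)).trans ?_
  gcongr
  exact Eventually.of_forall fun a => by positivity

theorem tendsto_integral_norm_sq_sub_starProjection_comp [Countable ι]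
    (b : HilbertBasis ι ℝ F) (e : HilbertBasis κ ℝ H) {Φ : α → H →L[ℝ] F} (hΦ : AEStronglyMeasurable Φ μ)
    (hHS : ∀ᵐ a ∂μ, Summable fun k => ‖Φ a (e k)‖ ^ 2)
    (hint : Integrable (fun a => ‖Φ a‖ ^ 2) μ) :
    Tendsto (fun s => ∫ a, ‖Φ a - (finSpan b s).starProjection ∘L Φ a‖ ^ 2 ∂μ) atTop (𝓝 0) := by
  have := tendsto_integral_filter_of_dominated_convergence (μ := μ) (l := atTop)
    (F := fun s a => ‖Φ a - (finSpan b s).starProjection ∘L Φ a‖ ^ 2) (f := fun _ => (0 : ℝ))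
    (fun a => ‖Φ a‖ ^ 2)
    (Eventually.of_forall fun s => ((hΦ.sub
      ((ContinuousLinearMap.compL ℝ H F F
        (finSpan b s).starProjection).continuous.comp_aestronglyMeasurable hΦ)).norm.pow 2))
    (Eventually.of_forall fun s => Eventually.of_forall fun a => ?_) hint
    (hHS.mono fun a ha => tendsto_norm_sq_sub_starProjection_comp b e (Φ a) ha)
  · simpa using this
  · rw [norm_pow, norm_norm]
    refine pow_le_pow_left₀ (norm_nonneg _) (ContinuousLinearMap.opNorm_le_bound _
      (norm_nonneg _) fun x => ?_) 2
    exact (norm_sub_starProjection_le (finSpan b s) (Φ a x)).trans ((Φ a).le_opNorm x)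

end HilbertSchmidt

/-- The standard Hilbert basis of `ℓ²(ι)`. -/
def stdHilbertBasis (ι : Type*) : HilbertBasis ι ℝ (lp (fun _ : ι => ℝ) 2) :=
  HilbertBasis.ofRepr (LinearIsometryEquiv.refl ℝ _)

theorem stdHilbertBasis_eq_eVec (k : ℕ) : stdHilbertBasis ℕ k = eVec k := by
  rw [eVec, ← HilbertBasis.repr_symm_single]
  rfl

theorem integrableOn_opNorm_sq {N : ℕ} {T : ℝ} {Φ : ℝ → (HSp →L[ℝ] ESp N)}
    (hΦ_meas : AEStronglyMeasurable Φ (volume.restrict (Icc 0 T)))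
    (hΦ_HS : ∀ s ∈ Icc (0:ℝ) T, Summable fun k => ‖Φ s (eVec k)‖ ^ 2)
    (hΦ_int : IntegrableOn (fun s => ∑' k : ℕ, ‖Φ s (eVec k)‖ ^ 2) (Icc 0 T)) :
    IntegrableOn (fun s => ‖Φ s‖ ^ 2) (Icc 0 T) := by
  refine hΦ_int.mono' (hΦ_meas.norm.pow 2) ((ae_restrict_iff' measurableSet_Icc).2
    (Eventually.of_forall fun s hs => ?_))
  rw [norm_pow, norm_norm]
  simpa only [stdHilbertBasis_eq_eVec] using opNorm_sq_le_tsum (stdHilbertBasis ℕ) (Φ s)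
    (by simpa only [stdHilbertBasis_eq_eVec] using hΦ_HS s hs)

section Control

variable {N : ℕ} {T M : ℝ} {Φ : ℝ → (HSp →L[ℝ] ESp N)} {v : ℝ → HSp}

theorem norm_setIntegral_control_le (hT : 0 < T)
    (hΦ_meas : AEStronglyMeasurable Φ (volume.restrict (Icc 0 T)))
    (hΦ_sq : IntegrableOn (fun s => ‖Φ s‖ ^ 2) (Icc 0 T)) (hv : IsControl T v)
    (hM : (∫ s in (0:ℝ)..T, ‖v s‖ ^ 2) ≤ M) {A : Set ℝ} (hA : A ⊆ Icc 0 T) :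
    ‖∫ s in A, Φ s (v s)‖ ≤ √(∫ s in A, ‖Φ s‖ ^ 2) * √M := by
  rw [intervalIntegral.integral_of_le hT.le, ← integral_Icc_eq_integral_Ioc] at hM
  refine (norm_setIntegral_clm_apply_le hA hΦ_meas hΦ_sq hv.1 hv.2).trans ?_
  gcongr

theorem Ioc_zero_subset_Icc {t : ℝ} (ht : t ∈ Icc 0 T) : Ioc 0 t ⊆ Icc 0 T :=
  Ioc_subset_Icc_self.trans (Icc_subset_Icc_right ht.2)

theorem norm_hatT_le (hT : 0 < T)
    (hΦ_meas : AEStronglyMeasurable Φ (volume.restrict (Icc 0 T)))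
    (hΦ_sq : IntegrableOn (fun s => ‖Φ s‖ ^ 2) (Icc 0 T)) (hv : IsControl T v)
    (hM : (∫ s in (0:ℝ)..T, ‖v s‖ ^ 2) ≤ M) {t : ℝ} (ht : t ∈ Icc 0 T) :
    ‖hatT Φ v t‖ ≤ √(∫ s in Icc 0 T, ‖Φ s‖ ^ 2) * √M := by
  rw [hatT, intervalIntegral.integral_of_le ht.1]
  refine (norm_setIntegral_control_le hT hΦ_meas hΦ_sq hv hM (Ioc_zero_subset_Icc ht)).trans ?_
  gcongr
  · exact Eventually.of_forall fun a => by positivity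
  · exact Ioc_zero_subset_Icc ht

theorem map_hatT (hΦ_meas : AEStronglyMeasurable Φ (volume.restrict (Icc 0 T)))
    (hΦ_sq : IntegrableOn (fun s => ‖Φ s‖ ^ 2) (Icc 0 T)) (hv : IsControl T v)
    (P : ESp N →L[ℝ] ESp N) {t : ℝ} (ht : t ∈ Icc 0 T) :
    hatT (fun s => P ∘L Φ s) v t = P (hatT Φ v t) := by
  rw [hatT, hatT, intervalIntegral.integral_of_le ht.1, intervalIntegral.integral_of_le ht.1,
    ← P.integral_comp_comm (IntegrableOn.mono_set
      (integrable_clm_apply hΦ_meas hΦ_sq hv.1 hv.2) (Ioc_zero_subset_Icc ht))]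
  rfl

theorem dist_hatT_le (hT : 0 < T)
    (hΦ_meas : AEStronglyMeasurable Φ (volume.restrict (Icc 0 T)))
    (hΦ_sq : IntegrableOn (fun s => ‖Φ s‖ ^ 2) (Icc 0 T)) (hv : IsControl T v)
    (hM : (∫ s in (0:ℝ)..T, ‖v s‖ ^ 2) ≤ M) {r t : ℝ} (hr : r ∈ Icc 0 T) (ht : t ∈ Icc 0 T) :
    dist (hatT Φ v r) (hatT Φ v t) ≤
      √|(∫ s in (0:ℝ)..t, ‖Φ s‖ ^ 2) - ∫ s in (0:ℝ)..r, ‖Φ s‖ ^ 2| * √M := by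
  wlog hrt : r ≤ t generalizing r t
  · rw [dist_comm, abs_sub_comm]
    exact this ht hr (le_of_not_ge hrt)
  have hsub : Ioc r t ⊆ Icc 0 T := Ioc_subset_Icc_self.trans (Icc_subset_Icc hr.1 ht.2)
  have hI {E : Type} [NormedAddCommGroup E] [NormedSpace ℝ E] {f : ℝ → E}
      (hf : IntegrableOn f (Icc 0 T)) :
      (∫ s in (0:ℝ)..t, f s) - ∫ s in (0:ℝ)..r, f s = ∫ s in Ioc r t, f s := by
    rw [intervalIntegral.integral_interval_sub_left, intervalIntegral.integral_of_le hrt]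
    · exact (intervalIntegrable_iff_integrableOn_Ioc_of_le ht.1).2
        (hf.mono_set (Ioc_zero_subset_Icc ht))
    · exact (intervalIntegrable_iff_integrableOn_Ioc_of_le hr.1).2
        (hf.mono_set (Ioc_zero_subset_Icc hr))
  rw [dist_comm, dist_eq_norm, hatT, hatT, hI (integrable_clm_apply hΦ_meas hΦ_sq hv.1 hv.2),
    hI hΦ_sq, abs_of_nonneg (integral_nonneg fun s => by positivity)]
  exact norm_setIntegral_control_le hT hΦ_meas hΦ_sq hv hM hsub

/-- The values of `T̂` on a bounded set of controls form a totally bounded set. -/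
theorem totallyBounded_hatT (hT : 0 < T)
    (hΦ_meas : AEStronglyMeasurable Φ (volume.restrict (Icc 0 T)))
    (hΦ_HS : ∀ s ∈ Icc (0:ℝ) T, Summable fun k => ‖Φ s (eVec k)‖ ^ 2)
    (hΦ_sq : IntegrableOn (fun s => ‖Φ s‖ ^ 2) (Icc 0 T)) (M : ℝ) :
    TotallyBounded {x | ∃ v, IsControl T v ∧ (∫ s in (0:ℝ)..T, ‖v s‖ ^ 2) ≤ M ∧
      ∃ t ∈ Icc 0 T, hatT Φ v t = x} := by
  refine totallyBounded_of_starProjection (stdHilbertBasis (Fin N → ℤ))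
    (C := √(∫ s in Icc 0 T, ‖Φ s‖ ^ 2) * √M) ?_ fun ε hε => ?_
  · rintro _ ⟨v, hv, hM, t, ht, rfl⟩
    exact norm_hatT_le hT hΦ_meas hΦ_sq hv hM ht
  have hlim := ((tendsto_integral_norm_sq_sub_starProjection_comp (stdHilbertBasis (Fin N → ℤ))
    (stdHilbertBasis ℕ) hΦ_meas ((ae_restrict_iff' measurableSet_Icc).2
      (Eventually.of_forall fun s hs => by
        simpa only [stdHilbertBasis_eq_eVec] using hΦ_HS s hs)) hΦ_sq).sqrt).mul_const (√M)
  rw [Real.sqrt_zero, zero_mul] at hlim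
  obtain ⟨s, hs⟩ := (hlim.eventually_lt_const hε).exists
  refine ⟨s, ?_⟩
  rintro _ ⟨v, hv, hM, t, ht, rfl⟩
  set Q : ESp N →L[ℝ] ESp N := ContinuousLinearMap.id ℝ _ -
    (finSpan (stdHilbertBasis (Fin N → ℤ)) s).starProjection
  have hQΦ : ∀ a, Q ∘L Φ a =
      Φ a - (finSpan (stdHilbertBasis (Fin N → ℤ)) s).starProjection ∘L Φ a := fun a => rfl
  have hQ_meas : AEStronglyMeasurable (fun a => Q ∘L Φ a) (volume.restrict (Icc 0 T)) :=
    (ContinuousLinearMap.compL ℝ HSp (ESp N) (ESp N) Q).continuous.comp_aestronglyMeasurable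
      hΦ_meas
  have hQ_sq : IntegrableOn (fun a => ‖Q ∘L Φ a‖ ^ 2) (Icc 0 T) := by
    refine (hΦ_sq.const_mul (‖Q‖ ^ 2)).mono' (hQ_meas.norm.pow 2)
      (Eventually.of_forall fun a => ?_)
    rw [norm_pow, norm_norm, ← mul_pow]
    exact pow_le_pow_left₀ (norm_nonneg _) (Q.opNorm_comp_le (Φ a)) 2
  change ‖Q (hatT Φ v t)‖ < ε
  rw [← map_hatT hΦ_meas hΦ_sq hv Q ht]
  refine (norm_hatT_le hT hQ_meas hQ_sq hv hM ht).trans_lt ?_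
  simpa only [hQΦ] using hs

end Control


/-- With `ξ ∈ L^∞(0,T;ℓ²)` fixed and `T̂(v)(t) = ∫₀ᵗ σ(s,ξ(s))v(s) ds`,
where `Φ s = σ(s,ξ(s)) : H → ℓ²` is Hilbert–Schmidt with integrable squared HS-norm,
the operator `T̂ : L²(0,T;H) → C([0,T],ℓ²)` is compact: the image of every bounded
set is precompact, i.e. every bounded sequence of controls has a subsequence whose
images under `T̂` converge uniformly on `[0,T]`. -/
theorem stmt14 (N : ℕ) (T : ℝ) (hT : 0 < T)
    (Φ : ℝ → (HSp →L[ℝ] ESp N))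
    (hΦ_meas : AEStronglyMeasurable Φ (volume.restrict (Icc 0 T)))
    (hΦ_HS : ∀ s ∈ Icc (0:ℝ) T, Summable fun k => ‖Φ s (eVec k)‖ ^ 2)
    (hΦ_int : IntegrableOn (fun s => ∑' k : ℕ, ‖Φ s (eVec k)‖ ^ 2) (Icc 0 T)) :
    ∀ M > (0:ℝ), ∀ vn : ℕ → ℝ → HSp,
      (∀ n, IsControl T (vn n)) →
      (∀ n, (∫ s in (0:ℝ)..T, ‖vn n s‖ ^ 2) ≤ M) →
      ∃ φ : ℕ → ℕ, StrictMono φ ∧ ∃ w : ℝ → ESp N,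
        ∀ ε > (0:ℝ), ∃ k₀ : ℕ, ∀ k ≥ k₀, ∀ t ∈ Icc (0:ℝ) T,
          ‖hatT Φ (vn (φ k)) t - w t‖ ≤ ε := by
  intro M _ vn hvn hM
  have hΦ_sq := integrableOn_opNorm_sq hΦ_meas hΦ_HS hΦ_int
  have hG : ContinuousOn (fun t => ∫ s in (0:ℝ)..t, ‖Φ s‖ ^ 2) (Icc 0 T) :=
    (intervalIntegral.continuousOn_primitive hΦ_sq).congr fun t ht =>
      intervalIntegral.integral_of_le ht.1
  have hequi : Equicontinuous fun (n : ℕ) (t : Icc (0:ℝ) T) => hatT Φ (vn n) t := by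
    intro r
    refine Metric.equicontinuousAt_of_continuity_modulus
      (fun t : Icc (0:ℝ) T => √|(∫ s in (0:ℝ)..t, ‖Φ s‖ ^ 2) - ∫ s in (0:ℝ)..r, ‖Φ s‖ ^ 2| * √M) ?_ _
      (Eventually.of_forall fun t n =>
        dist_hatT_le hT hΦ_meas hΦ_sq (hvn n) (hM n) r.2 t.2)
    have hGr := hG.domRestrict.tendsto r
    have hlim := ((hGr.sub_const (∫ s in (0:ℝ)..r, ‖Φ s‖ ^ 2)).abs.sqrt).mul_const (√M)
    rwa [domRestrict_apply, sub_self, abs_zero, Real.sqrt_zero, zero_mul] at hlim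
  let f (n : ℕ) : BoundedContinuousFunction (Icc (0:ℝ) T) (ESp N) :=
    BoundedContinuousFunction.mkOfCompact ⟨fun t => hatT Φ (vn n) t, hequi.continuous n⟩
  have hcompact : IsCompact (closure (range f)) := by
    have hK := (totallyBounded_hatT hT hΦ_meas hΦ_HS hΦ_sq M).closure.isCompact_of_isClosed
      isClosed_closure
    refine BoundedContinuousFunction.arzela_ascoli _ hK _ ?_ ?_
    · rintro _ t ⟨n, rfl⟩
      exact subset_closure ⟨vn n, hvn n, hM n, t, t.2, rfl⟩
    · intro r U hU
      filter_upwards [hequi r U hU] with t ht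
      rintro ⟨_, n, rfl⟩
      exact ht n
  obtain ⟨g, -, φ, hφ, hlim⟩ := hcompact.tendsto_subseq fun n => subset_closure (mem_range_self n)
  refine ⟨φ, hφ, fun t => if ht : t ∈ Icc (0:ℝ) T then g ⟨t, ht⟩ else 0, fun ε hε => ?_⟩
  obtain ⟨k₀, hk₀⟩ := Metric.tendsto_atTop.1 hlim ε hε
  refine ⟨k₀, fun k hk t ht => ?_⟩
  simp only [dif_pos ht]
  rw [← dist_eq_norm]
  exact (BoundedContinuousFunction.dist_coe_le_dist (f := f (φ k)) (g := g) ⟨t, ht⟩).trans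
    (hk₀ k hk).le
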